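/- Let w ∈ A−_xy. Then: the number of z ∈ A−_xy adjacent to w such that the edge wz has type 0 equals (q−1)·[i]; the number of z ∈ A0_xy adjacent to w such that the edge wz has type − equals (q−1)·[i]; the number of z ∈ A−_xy adjacent to w such that the edge wz has type − equals q·[k] − q^i − q; and for every other pair (N, t) with N among A0_xy, A+_xy, A−_xy and t among the types 0, +, −, the number of z ∈ N adjacent to w such that the edge wz has type t equals 0. -/

import Mathlib

open scoped Classical

noncomputable section

variable {F V : Type} [Field F] [AddCommGroup V] [Module F V]

/-- `v` covers `u` in the projective geometry `P`. -/
def Covers (u v : Submodule F V) : Prop :=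
  u ≤ v ∧ Module.finrank F ↥v = Module.finrank F ↥u + 1

/-- `v` slash-covers `u` (relative to the fixed subspace `y`). -/
def SlashCovers (y u v : Submodule F V) : Prop :=
  Covers u v ∧ Module.finrank F ↥(v ⊓ y) = Module.finrank F ↥(u ⊓ y) + 1

/-- `v` backslash-covers `u` (relative to the fixed subspace `y`). -/
def BackslashCovers (y u v : Submodule F V) : Prop :=
  Covers u v ∧ Module.finrank F ↥(v ⊓ y) = Module.finrank F ↥(u ⊓ y)

/-- `q` raised to a real exponent, as a complex number. -/
def qpow (q : ℕ) (e : ℝ) : ℂ := (((q : ℝ) ^ e : ℝ) : ℂ)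

/-- The Gaussian bracket `[m] = (q^m - 1)/(q - 1)` as a rational number. -/
def gaussQ (q m : ℕ) : ℚ := ((q : ℚ) ^ m - 1) / ((q : ℚ) - 1)

/-- The Gaussian bracket `[m] = (q^m - 1)/(q - 1)` as a complex number. -/
def gaussC (q m : ℕ) : ℂ := ((q : ℂ) ^ m - 1) / ((q : ℂ) - 1)

/-- The diagonal matrix `K1`; the `(u,u)` entry is `q^(k/2 - i)` for `u ∈ P_{i,j}`. -/
def matK1 (q k : ℕ) (y : Submodule F V) : Matrix (Submodule F V) (Submodule F V) ℂ :=
  Matrix.diagonal fun u => qpow q ((k : ℝ) / 2 - (Module.finrank F ↥(u ⊓ y) : ℝ))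

/-- The diagonal matrix `K2`; the `(u,u)` entry is `q^(j - (n-k)/2)` for `u ∈ P_{i,j}`. -/
def matK2 (q n k : ℕ) (y : Submodule F V) : Matrix (Submodule F V) (Submodule F V) ℂ :=
  Matrix.diagonal fun u =>
    qpow q (((Module.finrank F ↥u : ℝ) - (Module.finrank F ↥(u ⊓ y) : ℝ))
      - ((n : ℝ) - (k : ℝ)) / 2)

/-- The 0-1 matrix `L1`; the `(u,v)` entry is `1` iff `v` slash-covers `u`. -/
def matL1 (y : Submodule F V) : Matrix (Submodule F V) (Submodule F V) ℂ :=
  Matrix.of fun u v => if SlashCovers y u v then (1 : ℂ) else 0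

/-- The 0-1 matrix `L2`; the `(u,v)` entry is `1` iff `v` backslash-covers `u`. -/
def matL2 (y : Submodule F V) : Matrix (Submodule F V) (Submodule F V) ℂ :=
  Matrix.of fun u v => if BackslashCovers y u v then (1 : ℂ) else 0

/-- `R1 = L1ᵀ`. -/
def matR1 (y : Submodule F V) : Matrix (Submodule F V) (Submodule F V) ℂ := Matrix.transpose (matL1 y)

/-- `R2 = L2ᵀ`. -/
def matR2 (y : Submodule F V) : Matrix (Submodule F V) (Submodule F V) ℂ := Matrix.transpose (matL2 y)

/-- `R = L1 · R2`. -/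
def matR [Fintype (Submodule F V)] (y : Submodule F V) :
    Matrix (Submodule F V) (Submodule F V) ℂ := matL1 y * matR2 y

/-- `L = R1 · L2`. -/
def matL [Fintype (Submodule F V)] (y : Submodule F V) :
    Matrix (Submodule F V) (Submodule F V) ℂ := matR1 y * matL2 y

/-- The 0-1 matrix `F0`. -/
def matF0 (y : Submodule F V) : Matrix (Submodule F V) (Submodule F V) ℂ :=
  Matrix.of fun u v =>
    if SlashCovers y u (u ⊔ v) ∧ SlashCovers y v (u ⊔ v) ∧
        BackslashCovers y (u ⊓ v) u ∧ BackslashCovers y (u ⊓ v) v then (1 : ℂ) else 0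

/-- The 0-1 matrix `F+`. -/
def matFp (y : Submodule F V) : Matrix (Submodule F V) (Submodule F V) ℂ :=
  Matrix.of fun u v =>
    if BackslashCovers y u (u ⊔ v) ∧ BackslashCovers y v (u ⊔ v) then (1 : ℂ) else 0

/-- The 0-1 matrix `F-`. -/
def matFm (y : Submodule F V) : Matrix (Submodule F V) (Submodule F V) ℂ :=
  Matrix.of fun u v =>
    if SlashCovers y (u ⊓ v) u ∧ SlashCovers y (u ⊓ v) v then (1 : ℂ) else 0

/-- The vertex set `X` of the Grassmann graph: `k`-dimensional subspaces of `V`. -/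
abbrev GrassVertex (F V : Type) [Field F] [AddCommGroup V] [Module F V] (k : ℕ) :=
  {z : Submodule F V // Module.finrank F ↥z = k}

/-- The Grassmann graph `J_q(n,k)`: vertices are adjacent iff their intersection
has dimension `k - 1`. -/
def Grass (F V : Type) [Field F] [AddCommGroup V] [Module F V] (k : ℕ) :
    SimpleGraph (GrassVertex F V k) :=
  SimpleGraph.fromRel fun a b => Module.finrank F ↥(a.1 ⊓ b.1) = k - 1

/-- `B_xy = {z ∈ Γ(x) : ∂(z,y) = ∂(x,y) + 1}`. -/
def Bset {k : ℕ} (x y : GrassVertex F V k) : Set (GrassVertex F V k) :=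
  {z | (Grass F V k).Adj x z ∧ (Grass F V k).dist z y = (Grass F V k).dist x y + 1}

/-- `C_xy = {z ∈ Γ(x) : ∂(z,y) = ∂(x,y) - 1}`. -/
def Cset {k : ℕ} (x y : GrassVertex F V k) : Set (GrassVertex F V k) :=
  {z | (Grass F V k).Adj x z ∧ (Grass F V k).dist z y = (Grass F V k).dist x y - 1}

/-- `A_xy = {z ∈ Γ(x) : ∂(z,y) = ∂(x,y)}`. -/
def Aset {k : ℕ} (x y : GrassVertex F V k) : Set (GrassVertex F V k) :=
  {z | (Grass F V k).Adj x z ∧ (Grass F V k).dist z y = (Grass F V k).dist x y}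

/-- `A0_xy`. -/
def A0set {k : ℕ} (x y : GrassVertex F V k) : Set (GrassVertex F V k) :=
  {z | (Grass F V k).Adj x z ∧
    SlashCovers y.1 z.1 (z.1 ⊔ x.1) ∧ SlashCovers y.1 x.1 (z.1 ⊔ x.1) ∧
    BackslashCovers y.1 (z.1 ⊓ x.1) z.1 ∧ BackslashCovers y.1 (z.1 ⊓ x.1) x.1}

/-- `A+_xy`. -/
def Apset {k : ℕ} (x y : GrassVertex F V k) : Set (GrassVertex F V k) :=
  {z | (Grass F V k).Adj x z ∧
    BackslashCovers y.1 z.1 (z.1 ⊔ x.1) ∧ BackslashCovers y.1 x.1 (z.1 ⊔ x.1)}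

/-- `A-_xy`. -/
def Amset {k : ℕ} (x y : GrassVertex F V k) : Set (GrassVertex F V k) :=
  {z | (Grass F V k).Adj x z ∧
    SlashCovers y.1 (z.1 ⊓ x.1) z.1 ∧ SlashCovers y.1 (z.1 ⊓ x.1) x.1}

/-- The edge `wz` has type `0`. -/
def EdgeType0 {k : ℕ} (y w z : GrassVertex F V k) : Prop :=
  SlashCovers y.1 w.1 (w.1 ⊔ z.1) ∧ SlashCovers y.1 z.1 (w.1 ⊔ z.1) ∧
  BackslashCovers y.1 (w.1 ⊓ z.1) w.1 ∧ BackslashCovers y.1 (w.1 ⊓ z.1) z.1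

/-- The edge `wz` has type `+`. -/
def EdgeTypeP {k : ℕ} (y w z : GrassVertex F V k) : Prop :=
  BackslashCovers y.1 w.1 (w.1 ⊔ z.1) ∧ BackslashCovers y.1 z.1 (w.1 ⊔ z.1)

/-- The edge `wz` has type `-`. -/
def EdgeTypeM {k : ℕ} (y w z : GrassVertex F V k) : Prop :=
  SlashCovers y.1 (w.1 ⊓ z.1) w.1 ∧ SlashCovers y.1 (w.1 ⊓ z.1) z.1

open Module

section Counting

/-- The subspaces between `A` and `W` whose dimension exceeds that of `A` by one. -/
def linesBetween (A W : Submodule F V) : Set (Submodule F V) :=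
  {z | A ≤ z ∧ z ≤ W ∧ finrank F z = finrank F A + 1}

/-- The subspaces between `A` and `W` of codimension one in `W`. -/
def hyperplanesBetween (A W : Submodule F V) : Set (Submodule F V) :=
  {z | A ≤ z ∧ z ≤ W ∧ finrank F z + 1 = finrank F W}

theorem finite_submodule [Finite F] [FiniteDimensional F V] : Finite (Submodule F V) :=
  have : Finite V := Module.finite_of_finite F
  inferInstance

theorem ncard_submodule_diff [Fintype F] [FiniteDimensional F V] {A W : Submodule F V}
    (h : A ≤ W) :
    ((W : Set V) \ A).ncard =
      Fintype.card F ^ finrank F W - Fintype.card F ^ finrank F A := by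
  have : Finite V := Module.finite_of_finite F
  have card_eq (B : Submodule F V) : (B : Set V).ncard = Fintype.card F ^ finrank F B := by
    rw [← Nat.card_coe_set_eq, ← Nat.card_eq_fintype_card]
    exact Module.natCard_eq_pow_finrank
  rw [Set.ncard_sdiff (by exact_mod_cast h), card_eq, card_eq]

theorem ncard_linesBetween_mul [Fintype F] [FiniteDimensional F V] {A W : Submodule F V}
    (h : A ≤ W) :
    (linesBetween A W).ncard *
        (Fintype.card F ^ (finrank F A + 1) - Fintype.card F ^ finrank F A) =
      Fintype.card F ^ finrank F W - Fintype.card F ^ finrank F A := by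
  have : Finite V := Module.finite_of_finite F
  have : Fintype V := Fintype.ofFinite V
  have : Fintype (Submodule F V) := Fintype.ofFinite _
  rw [← ncard_submodule_diff h, Set.ncard_eq_toFinset_card' ((W : Set V) \ A),
    Set.ncard_eq_toFinset_card' (linesBetween A W),
    Finset.card_eq_sum_card_fiberwise (f := fun v => A ⊔ Submodule.span F {v})
      (t := (linesBetween A W).toFinset)]
  · rw [Finset.sum_const_nat]
    intro z hz
    obtain ⟨hAz, hzW, hd⟩ : z ∈ linesBetween A W := by simpa using hz
    rw [← hd, ← ncard_submodule_diff hAz, Set.ncard_eq_toFinset_card']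
    congr 1
    ext v
    simp only [Finset.mem_filter, Set.mem_toFinset, Set.mem_sdiff, SetLike.mem_coe]
    constructor
    · rintro ⟨⟨-, hvA⟩, rfl⟩
      exact ⟨Submodule.mem_sup_right (Submodule.mem_span_singleton_self v), hvA⟩
    · rintro ⟨hvz, hvA⟩
      refine ⟨⟨hzW hvz, hvA⟩, Submodule.eq_of_le_of_finrank_eq ?_ ?_⟩
      · exact sup_le hAz ((Submodule.span_singleton_le_iff_mem v z).2 hvz)
      · rw [Submodule.finrank_sup_span_singleton hvA, hd]
  · intro v hv
    obtain ⟨hvW, hvA⟩ : v ∈ W ∧ v ∉ A := by simpa using hv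
    simp only [Set.coe_toFinset]
    exact ⟨le_sup_left, sup_le h ((Submodule.span_singleton_le_iff_mem v W).2 hvW),
      Submodule.finrank_sup_span_singleton hvA⟩

theorem ncard_linesBetween [Fintype F] [FiniteDimensional F V] {A W : Submodule F V}
    (h : A ≤ W) :
    ((linesBetween A W).ncard : ℚ) =
      gaussQ (Fintype.card F) (finrank F W - finrank F A) := by
  have key := ncard_linesBetween_mul h
  obtain ⟨m, hm⟩ := Nat.exists_eq_add_of_le (Submodule.finrank_mono h)
  have hq : 1 < Fintype.card F := Fintype.one_lt_card
  have hq' : (1 : ℚ) < Fintype.card F := by exact_mod_cast hq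
  have key' := congrArg (Nat.cast : ℕ → ℚ) key
  rw [Nat.cast_mul, Nat.cast_sub (Nat.pow_le_pow_right hq.le (by omega)),
    Nat.cast_sub (Nat.pow_le_pow_right hq.le (by omega))] at key'
  rw [hm, Nat.add_sub_cancel_left, gaussQ, eq_div_iff (by linarith)]
  rw [hm] at key'
  push_cast [pow_add] at key'
  have hpos : (0 : ℚ) < (Fintype.card F : ℚ) ^ finrank F A := by positivity
  refine mul_right_cancel₀ hpos.ne' ?_
  linear_combination key'

theorem ncard_hyperplanesBetween [Fintype F] [FiniteDimensional F V] {A W : Submodule F V}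
    (h : A ≤ W) :
    ((hyperplanesBetween A W).ncard : ℚ) =
      gaussQ (Fintype.card F) (finrank F W - finrank F A) := by
  have hA := Subspace.finrank_add_finrank_dualAnnihilator_eq A
  have hW := Subspace.finrank_add_finrank_dualAnnihilator_eq W
  have hAW := Submodule.finrank_mono h
  have himage : (hyperplanesBetween A W) =
      (fun z : Submodule F V => z.dualAnnihilator) ⁻¹'
        (linesBetween W.dualAnnihilator A.dualAnnihilator) := by
    ext z
    have hz := Subspace.finrank_add_finrank_dualAnnihilator_eq z
    simp only [hyperplanesBetween, linesBetween, Set.mem_ofPred_eq, Set.mem_preimage,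
      Subspace.dualAnnihilator_le_dualAnnihilator_iff]
    constructor
    · rintro ⟨h1, h2, h3⟩
      exact ⟨h2, h1, by omega⟩
    · rintro ⟨h2, h1, h3⟩
      exact ⟨h1, h2, by omega⟩
  have hinj : Function.Injective (fun z : Submodule F V => z.dualAnnihilator) :=
    fun _ _ h => Subspace.dualAnnihilator_inj.1 h
  rw [himage, Set.ncard_preimage_of_injective_subset_range hinj,
    ncard_linesBetween (Subspace.dualAnnihilator_le_dualAnnihilator_iff.2 h)]
  · congr 1
    omega
  · intro z _
    exact ⟨z.dualCoannihilator, Subspace.dualCoannihilator_dualAnnihilator_eq⟩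

end Counting

section Geometry

theorem exists_le_finrank_add_one_eq [FiniteDimensional F V] {A W : Submodule F V}
    (h : A < W) : ∃ U, A ≤ U ∧ U ≤ W ∧ finrank F U + 1 = finrank F W := by
  obtain ⟨U, hAU, hUW⟩ := exists_le_covBy_of_lt h
  obtain ⟨v, hvW, hvU⟩ := SetLike.exists_of_lt hUW.lt
  refine ⟨U, hAU, hUW.le, ?_⟩
  have hv := Submodule.finrank_sup_span_singleton (K := F) hvU
  have hlt : U < U ⊔ Submodule.span F {v} :=
    lt_of_le_of_ne le_sup_left fun he =>
      hvU (he ▸ Submodule.mem_sup_right (Submodule.mem_span_singleton_self v))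
  have hle : U ⊔ Submodule.span F {v} ≤ W :=
    sup_le hUW.le ((Submodule.span_singleton_le_iff_mem v W).2 hvW)
  rw [← hv, (hUW.eq_or_eq hlt.le hle).resolve_left hlt.ne']

theorem finrank_inf_add_one_of_not_le [FiniteDimensional F V] {A z W : Submodule F V}
    (hz : z ≤ W) (hd : finrank F z + 1 = finrank F W) (hA : A ≤ W) (h : ¬A ≤ z) :
    finrank F ↥(A ⊓ z) + 1 = finrank F A := by
  have h1 := Submodule.finrank_sup_add_finrank_inf_eq A z
  have h2 := Submodule.finrank_mono (sup_le hA hz)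
  have h3 : finrank F ↥(A ⊓ z) < finrank F A :=
    Submodule.finrank_lt_finrank_of_lt (inf_lt_left.2 h)
  omega

/-- Two `k`-dimensional subspaces meeting in dimension `k - 1`. -/
structure AreAdjacent (k : ℕ) (a b : Submodule F V) : Prop where
  finrank_left : finrank F a = k
  finrank_right : finrank F b = k
  finrank_inf : finrank F ↥(a ⊓ b) + 1 = k

namespace AreAdjacent

variable {k : ℕ} {a b x w y z : Submodule F V}

theorem symm (h : AreAdjacent k a b) : AreAdjacent k b a :=
  ⟨h.finrank_right, h.finrank_left, inf_comm a b ▸ h.finrank_inf⟩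

theorem comm : AreAdjacent k a b ↔ AreAdjacent k b a := ⟨symm, symm⟩

theorem ne (h : AreAdjacent k a b) : a ≠ b := by
  rintro rfl
  have h1 := h.finrank_left
  have h2 := h.finrank_inf
  rw [inf_idem] at h2
  omega

theorem finrank_sup [FiniteDimensional F V] (h : AreAdjacent k a b) :
    finrank F ↥(a ⊔ b) = k + 1 := by
  have h1 := Submodule.finrank_sup_add_finrank_inf_eq a b
  have h2 := h.finrank_left
  have h3 := h.finrank_right
  have h4 := h.finrank_inf
  omega

theorem of_le_sup [FiniteDimensional F V] (h : AreAdjacent k x w) (hz : z ≤ x ⊔ w)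
    (hd : finrank F z = k) (hne : z ≠ x) : AreAdjacent k z x where
  finrank_left := hd
  finrank_right := h.finrank_left
  finrank_inf := by
    have hle : ¬z ≤ x := fun hzx =>
      hne (Submodule.eq_of_le_of_finrank_eq hzx (hd.trans h.finrank_left.symm))
    have := finrank_inf_add_one_of_not_le le_sup_left
      (by rw [h.finrank_sup, h.finrank_left]) hz hle
    omega

theorem sup_eq_of_le_sup [FiniteDimensional F V] (h : AreAdjacent k x w) (hz : z ≤ x ⊔ w)
    (hzx : AreAdjacent k z x) : z ⊔ x = x ⊔ w :=
  Submodule.eq_of_le_of_finrank_eq (sup_le hz le_sup_left)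
    (hzx.finrank_sup.trans h.finrank_sup.symm)

theorem inf_eq_of_inf_le [FiniteDimensional F V] (h : AreAdjacent k x w) (hz : x ⊓ w ≤ z)
    (hd : finrank F z = k) (hne : z ≠ x) : z ⊓ x = x ⊓ w := by
  have hle : ¬z ≤ x := fun hzx =>
    hne (Submodule.eq_of_le_of_finrank_eq hzx (hd.trans h.finrank_left.symm))
  have h1 := Submodule.finrank_lt_finrank_of_lt (inf_lt_left.2 hle)
  have h2 := h.finrank_inf
  exact (Submodule.eq_of_le_of_finrank_le (le_inf hz inf_le_left) (by omega)).symm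

/-- A common neighbour of `x` and `w` contains `x ⊓ w` or is contained in `x ⊔ w`. -/
theorem inf_le_or_le_sup [FiniteDimensional F V] (h : AreAdjacent k x w)
    (hzx : AreAdjacent k z x) (hwz : AreAdjacent k w z) : x ⊓ w ≤ z ∨ z ≤ x ⊔ w := by
  by_cases he : z ⊓ x ≤ w
  · left
    have h1 : z ⊓ x = x ⊓ w := Submodule.eq_of_le_of_finrank_eq (le_inf inf_le_right he) (by
      have := h.finrank_inf
      have := hzx.finrank_inf
      omega)
    exact h1 ▸ inf_le_left
  · right
    have h1 : ¬z ⊓ x ≤ w ⊓ z := fun hle => he (hle.trans inf_le_left)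
    have h2 := Submodule.finrank_lt_finrank_of_lt (right_lt_sup.2 h1)
    have h3 : z ⊓ x ⊔ w ⊓ z = z :=
      Submodule.eq_of_le_of_finrank_le (sup_le inf_le_left inf_le_right) (by
        have := hwz.finrank_inf
        have := hwz.finrank_right
        omega)
    rw [← h3]
    exact sup_le_sup inf_le_right inf_le_left

theorem covers [FiniteDimensional F V] (h : AreAdjacent k a b) :
    Covers a (a ⊔ b) ∧ Covers b (a ⊔ b) ∧ Covers (a ⊓ b) a ∧ Covers (a ⊓ b) b := by
  have h1 := h.finrank_sup
  have h2 := h.finrank_left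
  have h3 := h.finrank_right
  have h4 := h.finrank_inf
  exact ⟨⟨le_sup_left, by omega⟩, ⟨le_sup_right, by omega⟩, ⟨inf_le_left, by omega⟩,
    ⟨inf_le_right, by omega⟩⟩

theorem typeZero_iff [FiniteDimensional F V] (h : AreAdjacent k a b) :
    (SlashCovers y a (a ⊔ b) ∧ SlashCovers y b (a ⊔ b) ∧
      BackslashCovers y (a ⊓ b) a ∧ BackslashCovers y (a ⊓ b) b) ↔
    a ⊓ y = b ⊓ y ∧ finrank F ↥((a ⊔ b) ⊓ y) = finrank F ↥(a ⊓ y) + 1 := by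
  obtain ⟨h1, h2, h3, h4⟩ := h.covers
  simp only [SlashCovers, BackslashCovers, h1, h2, h3, h4, true_and]
  constructor
  · rintro ⟨e1, -, e3, e4⟩
    refine ⟨?_, e1⟩
    rw [← Submodule.eq_of_le_of_finrank_eq (inf_le_inf_right y inf_le_left) e3.symm,
      ← Submodule.eq_of_le_of_finrank_eq (inf_le_inf_right y inf_le_right) e4.symm]
  · rintro ⟨e1, e2⟩
    have e3 : a ⊓ b ⊓ y = a ⊓ y :=
      le_antisymm (inf_le_inf_right y inf_le_left)
        (le_inf (le_inf inf_le_left (e1 ▸ inf_le_left)) inf_le_right)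
    exact ⟨e2, e1 ▸ e2, by rw [e3], by rw [e3, e1]⟩

theorem typePlus_iff [FiniteDimensional F V] (h : AreAdjacent k a b) :
    (BackslashCovers y a (a ⊔ b) ∧ BackslashCovers y b (a ⊔ b)) ↔
    a ⊓ y = (a ⊔ b) ⊓ y ∧ b ⊓ y = (a ⊔ b) ⊓ y := by
  obtain ⟨h1, h2, h3, h4⟩ := h.covers
  simp only [BackslashCovers, h1, h2, true_and]
  constructor
  · rintro ⟨e1, e2⟩
    exact ⟨Submodule.eq_of_le_of_finrank_eq (inf_le_inf_right y le_sup_left) e1.symm,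
      Submodule.eq_of_le_of_finrank_eq (inf_le_inf_right y le_sup_right) e2.symm⟩
  · rintro ⟨e1, e2⟩
    exact ⟨by rw [e1], by rw [e2]⟩

theorem typeMinus_iff [FiniteDimensional F V] (h : AreAdjacent k a b) :
    (SlashCovers y (a ⊓ b) a ∧ SlashCovers y (a ⊓ b) b) ↔
    finrank F ↥(a ⊓ y) = finrank F ↥(a ⊓ b ⊓ y) + 1 ∧
      finrank F ↥(b ⊓ y) = finrank F ↥(a ⊓ b ⊓ y) + 1 := by
  obtain ⟨h1, h2, h3, h4⟩ := h.covers
  simp only [SlashCovers, h3, h4, true_and]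

end AreAdjacent

/-- Adjacent `x` and `w`, both meeting `y` in dimension `s`, with `x ⊓ w` meeting `y` in
dimension `s - 1`. -/
structure IsMinusPair (y : Submodule F V) (k s : ℕ) (x w : Submodule F V) : Prop
    extends AreAdjacent k x w where
  finrank_left_inf : finrank F ↥(x ⊓ y) = s
  finrank_right_inf : finrank F ↥(w ⊓ y) = s
  finrank_inf_inf : finrank F ↥(x ⊓ w ⊓ y) + 1 = s

namespace IsMinusPair

variable {k s : ℕ} {x w y z : Submodule F V}

theorem symm (h : IsMinusPair y k s x w) : IsMinusPair y k s w x :=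
  ⟨h.toAreAdjacent.symm, h.finrank_right_inf, h.finrank_left_inf,
    inf_comm x w ▸ h.finrank_inf_inf⟩

variable [FiniteDimensional F V]

theorem inf_sup_inf (h : IsMinusPair y k s x w) : x ⊓ w ⊔ x ⊓ y = x := by
  have h1 := Submodule.finrank_sup_add_finrank_inf_eq (x ⊓ w) (x ⊓ y)
  rw [← inf_inf_distrib_left, ← inf_assoc] at h1
  refine Submodule.eq_of_le_of_finrank_eq (sup_le inf_le_left inf_le_left) ?_
  have := h.finrank_left
  have := h.finrank_inf
  have := h.finrank_left_inf
  have := h.finrank_inf_inf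
  omega

theorem sup_inf_eq (h : IsMinusPair y k s x w) : (x ⊔ w) ⊓ y = x ⊓ y ⊔ w ⊓ y := by
  have h1 := Submodule.finrank_sup_add_finrank_inf_eq (x ⊓ y) (w ⊓ y)
  rw [← inf_inf_distrib_right] at h1
  have h2 := Submodule.finrank_sup_add_finrank_inf_eq ((x ⊔ w) ⊓ y) x
  have h3 : (x ⊔ w) ⊓ y ⊓ x = x ⊓ y := by
    rw [inf_right_comm, inf_eq_right.2 (le_sup_left : x ≤ x ⊔ w)]
  have h4 := Submodule.finrank_mono
    (sup_le inf_le_left le_sup_left : (x ⊔ w) ⊓ y ⊔ x ≤ x ⊔ w)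
  rw [h3] at h2
  refine (Submodule.eq_of_le_of_finrank_le
    (sup_le (inf_le_inf_right y le_sup_left) (inf_le_inf_right y le_sup_right)) ?_).symm
  have := h.finrank_sup
  have := h.finrank_left
  have := h.finrank_left_inf
  have := h.finrank_right_inf
  have := h.finrank_inf_inf
  omega

theorem finrank_sup_inf (h : IsMinusPair y k s x w) :
    finrank F ↥((x ⊔ w) ⊓ y) = s + 1 := by
  have h1 := Submodule.finrank_sup_add_finrank_inf_eq (x ⊓ y) (w ⊓ y)
  rw [← inf_inf_distrib_right, ← h.sup_inf_eq] at h1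
  have := h.finrank_left_inf
  have := h.finrank_right_inf
  have := h.finrank_inf_inf
  omega

theorem not_inf_le (h : IsMinusPair y k s x w) : ¬x ⊓ y ≤ w := fun hle => by
  have h1 := Submodule.finrank_mono
    (le_inf (le_inf inf_le_left hle) inf_le_right : x ⊓ y ≤ x ⊓ w ⊓ y)
  have := h.finrank_left_inf
  have := h.finrank_inf_inf
  omega

theorem eq_of_inf_le (h : IsMinusPair y k s x w) (h1 : x ⊓ w ≤ z) (h2 : x ⊓ y ≤ z)
    (hd : finrank F z = k) : z = x :=
  (Submodule.eq_of_le_of_finrank_eq (h.inf_sup_inf ▸ sup_le h1 h2)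
    (h.finrank_left.trans hd.symm)).symm

theorem of_typeMinus (h : AreAdjacent k z x) (hx : finrank F ↥(x ⊓ y) = s)
    (hm : SlashCovers y (z ⊓ x) z ∧ SlashCovers y (z ⊓ x) x) : IsMinusPair y k s z x := by
  obtain ⟨h1, h2⟩ := h.typeMinus_iff.1 hm
  exact ⟨h, by omega, hx, by omega⟩

theorem typeMinus (h : IsMinusPair y k s z x) :
    SlashCovers y (z ⊓ x) z ∧ SlashCovers y (z ⊓ x) x :=
  h.typeMinus_iff.2 ⟨by rw [h.finrank_left_inf, h.finrank_inf_inf],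
    by rw [h.finrank_right_inf, h.finrank_inf_inf]⟩

theorem finrank_inf_of_le_sup (h : IsMinusPair y k s x w) (hz : z ≤ x ⊔ w)
    (hd : finrank F z = k) (hy : ¬(x ⊔ w) ⊓ y ≤ z) : finrank F ↥(z ⊓ y) = s := by
  have h1 := finrank_inf_add_one_of_not_le hz (by rw [hd, h.finrank_sup]) inf_le_left hy
  have h2 : (x ⊔ w) ⊓ y ⊓ z = z ⊓ y := by rw [inf_right_comm, inf_eq_right.2 hz]
  rw [h2, h.finrank_sup_inf] at h1
  omega

/-- A neighbour `z` of `x` meeting `y` in `x ⊓ y` that is also a neighbour of `w` lies in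
`x ⊔ w`. -/
theorem le_sup_of_inf_eq (h : IsMinusPair y k s x w) (hzx : AreAdjacent k z x)
    (hwz : AreAdjacent k w z) (he : z ⊓ y = x ⊓ y) : z ≤ x ⊔ w :=
  (h.inf_le_or_le_sup hzx hwz).resolve_left fun hle =>
    hzx.ne (h.eq_of_inf_le hle (he ▸ inf_le_left) hzx.finrank_left)

theorem not_typePlus (h : IsMinusPair y k s x w) (hzx : AreAdjacent k z x)
    (hwz : AreAdjacent k w z) :
    ¬(BackslashCovers y z (z ⊔ x) ∧ BackslashCovers y x (z ⊔ x)) := by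
  rw [hzx.typePlus_iff]
  rintro ⟨h1, h2⟩
  rw [h.sup_eq_of_le_sup (h.le_sup_of_inf_eq hzx hwz (h1.trans h2.symm)) hzx] at h2
  have h3 := h.finrank_left_inf
  rw [h2, h.finrank_sup_inf] at h3
  omega

theorem inf_ne_inf (h : IsMinusPair y k s x w) : x ⊓ y ≠ w ⊓ y := fun he =>
  h.not_inf_le (he ▸ inf_le_left)

theorem typeMinus_and_typeZero_iff (h : IsMinusPair y k s x w) :
    ((AreAdjacent k z x ∧ SlashCovers y (z ⊓ x) z ∧ SlashCovers y (z ⊓ x) x) ∧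
      AreAdjacent k w z ∧ SlashCovers y w (w ⊔ z) ∧ SlashCovers y z (w ⊔ z) ∧
        BackslashCovers y (w ⊓ z) w ∧ BackslashCovers y (w ⊓ z) z) ↔
    z ∈ (hyperplanesBetween (w ⊓ y) (x ⊔ w) \ hyperplanesBetween ((x ⊔ w) ⊓ y) (x ⊔ w)) \
      {w} := by
  constructor
  · rintro ⟨⟨hzx, hm⟩, hwz, hz⟩
    have hp := of_typeMinus hzx h.finrank_left_inf hm
    obtain ⟨he, -⟩ := hwz.typeZero_iff.1 hz
    have hle : z ≤ w ⊔ x := h.symm.le_sup_of_inf_eq hwz.symm hzx.symm he.symm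
    rw [sup_comm] at hle
    refine ⟨⟨⟨he ▸ inf_le_left, hle, by rw [hzx.finrank_left, h.finrank_sup]⟩, ?_⟩,
      hwz.symm.ne⟩
    rintro ⟨h1, -⟩
    exact hp.symm.not_inf_le ((inf_le_inf_right y le_sup_left).trans h1)
  · rintro ⟨⟨⟨h1, h2, h3⟩, h4⟩, h5⟩
    have h4' : ¬(x ⊔ w) ⊓ y ≤ z := fun hle => h4 ⟨hle, h2, h3⟩
    have hd : finrank F z = k := by rw [h.finrank_sup] at h3; omega
    have hzy := h.finrank_inf_of_le_sup h2 hd h4'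
    have he : w ⊓ y = z ⊓ y :=
      Submodule.eq_of_le_of_finrank_eq (le_inf h1 inf_le_right)
        (h.finrank_right_inf.trans hzy.symm)
    have hzx : AreAdjacent k z x := h.of_le_sup h2 hd (by
      rintro rfl
      exact h.symm.not_inf_le h1)
    have hwz : AreAdjacent k w z :=
      (h.symm.toAreAdjacent.of_le_sup (sup_comm x w ▸ h2) hd h5).symm
    have hwz_sup : z ⊔ w = x ⊔ w :=
      (h.symm.toAreAdjacent.sup_eq_of_le_sup (sup_comm x w ▸ h2) hwz.symm).trans
        (sup_comm w x)
    refine ⟨⟨hzx, typeMinus (s := s) ⟨hzx, hzy, h.finrank_left_inf, ?_⟩⟩, hwz,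
      hwz.typeZero_iff.2 ⟨he, ?_⟩⟩
    · rw [inf_right_comm, ← he, inf_right_comm, inf_comm w x]
      exact h.finrank_inf_inf
    · rw [sup_comm, hwz_sup, h.finrank_sup_inf, h.finrank_right_inf]

theorem typeMinus_and_typeMinus_iff (h : IsMinusPair y k s x w) :
    ((AreAdjacent k z x ∧ SlashCovers y (z ⊓ x) z ∧ SlashCovers y (z ⊓ x) x) ∧
      AreAdjacent k w z ∧ SlashCovers y (w ⊓ z) w ∧ SlashCovers y (w ⊓ z) z) ↔
    z ∈ (linesBetween (x ⊓ w) (x ⊓ w ⊔ y) \ {x, w}) ∪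
      ((hyperplanesBetween ⊥ (x ⊔ w) \
        (hyperplanesBetween (x ⊓ y) (x ⊔ w) ∪ hyperplanesBetween (w ⊓ y) (x ⊔ w))) \
        linesBetween (x ⊓ w) (x ⊔ w)) := by
  constructor
  · rintro ⟨⟨hzx, hm⟩, hwz, hm'⟩
    have hp := of_typeMinus hzx h.finrank_left_inf hm
    have hp' : IsMinusPair y k s w z := of_typeMinus hwz hp.finrank_left_inf hm'
    have hd := hzx.finrank_left
    by_cases hle : x ⊓ w ≤ z
    · left
      refine ⟨⟨hle, ?_, hd.trans h.finrank_inf.symm⟩, ?_⟩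
      · have he := h.inf_eq_of_inf_le hle hd hzx.ne
        rw [← he]
        nth_rw 1 [← hp.inf_sup_inf]
        exact sup_le_sup_left inf_le_right _
      · rintro (rfl | rfl)
        exacts [hzx.ne rfl, hwz.ne rfl]
    · right
      have hle' := (h.inf_le_or_le_sup hzx hwz).resolve_left hle
      refine ⟨⟨⟨bot_le, hle', by rw [hd, h.finrank_sup]⟩, ?_⟩, fun hl => hle hl.1⟩
      rintro (⟨h1, -⟩ | ⟨h1, -⟩)
      exacts [hp.symm.not_inf_le h1, hp'.not_inf_le h1]
  · rintro (⟨⟨h1, h2, h3⟩, h4⟩ | ⟨⟨⟨-, h2, h3⟩, h4⟩, -⟩)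
    · have hd : finrank F z = k := h3.trans h.finrank_inf
      have hne : z ≠ x := fun he => h4 (Or.inl he)
      have hne' : z ≠ w := fun he => h4 (Or.inr he)
      have he := h.inf_eq_of_inf_le h1 hd hne
      have he' : z ⊓ w = w ⊓ x :=
        h.symm.toAreAdjacent.inf_eq_of_inf_le (inf_comm x w ▸ h1) hd hne'
      have hzx : AreAdjacent k z x := ⟨hd, h.finrank_left, by rw [he, h.finrank_inf]⟩
      have hwz : AreAdjacent k w z :=
        ⟨h.finrank_right, hd, by rw [inf_comm, he', h.symm.finrank_inf]⟩
      have hzy : finrank F ↥(z ⊓ y) = s := by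
        have e1 : x ⊓ w ⊔ y ⊓ z = z := by
          rw [← sup_inf_assoc_of_le y h1, inf_eq_right.2 h2]
        have e2 := Submodule.finrank_sup_add_finrank_inf_eq (x ⊓ w) (y ⊓ z)
        have e3 : x ⊓ w ⊓ (y ⊓ z) = x ⊓ w ⊓ y := by
          rw [← inf_assoc]
          exact inf_eq_left.2 (inf_le_left.trans h1)
        rw [e1, e3, inf_comm y z] at e2
        have := h.finrank_inf
        have := h.finrank_inf_inf
        omega
      have hp : IsMinusPair y k s z x :=
        ⟨hzx, hzy, h.finrank_left_inf, by rw [he, h.finrank_inf_inf]⟩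
      have hp' : IsMinusPair y k s w z :=
        ⟨hwz, h.finrank_right_inf, hzy, by rw [inf_comm w z, he', h.symm.finrank_inf_inf]⟩
      exact ⟨⟨hzx, hp.typeMinus⟩, hwz, hp'.typeMinus⟩
    · have hd : finrank F z = k := by rw [h.finrank_sup] at h3; omega
      have hx : ¬x ⊓ y ≤ z := fun hle => h4 (Or.inl ⟨hle, h2, h3⟩)
      have hw : ¬w ⊓ y ≤ z := fun hle => h4 (Or.inr ⟨hle, h2, h3⟩)
      have hzx : AreAdjacent k z x := h.of_le_sup h2 hd (by
        rintro rfl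
        exact hx inf_le_left)
      have hwz : AreAdjacent k w z :=
        (h.symm.toAreAdjacent.of_le_sup (sup_comm x w ▸ h2) hd (by
          rintro rfl
          exact hw inf_le_left)).symm
      have hzy := h.finrank_inf_of_le_sup h2 hd fun hle =>
        hx ((inf_le_inf_right y le_sup_left).trans hle)
      have ex := finrank_inf_add_one_of_not_le h2 h3 (inf_le_left.trans le_sup_left) hx
      have ew := finrank_inf_add_one_of_not_le h2 h3 (inf_le_left.trans le_sup_right) hw
      have hp : IsMinusPair y k s z x :=
        ⟨hzx, hzy, h.finrank_left_inf, by
          rw [inf_comm z x, inf_right_comm, ex, h.finrank_left_inf]⟩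
      have hp' : IsMinusPair y k s w z :=
        ⟨hwz, h.finrank_right_inf, hzy, by rw [inf_right_comm, ew, h.finrank_right_inf]⟩
      exact ⟨⟨hzx, hp.typeMinus⟩, hwz, hp'.typeMinus⟩

end IsMinusPair

end Geometry

section Cardinalities

namespace IsMinusPair

variable [Fintype F] [FiniteDimensional F V] {k s : ℕ} {x w y : Submodule F V}

theorem ncard_hyperplanesBetween_inf (h : IsMinusPair y k s x w) :
    ((hyperplanesBetween (x ⊓ y) (x ⊔ w)).ncard : ℚ) =
      gaussQ (Fintype.card F) (k + 1 - s) := by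
  rw [ncard_hyperplanesBetween (inf_le_left.trans le_sup_left), h.finrank_sup,
    h.finrank_left_inf]

theorem ncard_hyperplanesBetween_sup_inf (h : IsMinusPair y k s x w) :
    ((hyperplanesBetween ((x ⊔ w) ⊓ y) (x ⊔ w)).ncard : ℚ) =
      gaussQ (Fintype.card F) (k - s) := by
  rw [ncard_hyperplanesBetween inf_le_left, h.finrank_sup, h.finrank_sup_inf,
    Nat.add_sub_add_right]

theorem ncard_typeMinus_typeZero (h : IsMinusPair y k s x w) :
    (((hyperplanesBetween (w ⊓ y) (x ⊔ w) \ hyperplanesBetween ((x ⊔ w) ⊓ y) (x ⊔ w)) \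
      {w}).ncard : ℚ) =
      gaussQ (Fintype.card F) (k + 1 - s) - gaussQ (Fintype.card F) (k - s) - 1 := by
  have := finite_submodule (F := F) (V := V)
  have h1 : hyperplanesBetween ((x ⊔ w) ⊓ y) (x ⊔ w) ⊆ hyperplanesBetween (w ⊓ y) (x ⊔ w) :=
    fun z hz => ⟨(inf_le_inf_right y le_sup_right).trans hz.1, hz.2⟩
  have h2 : w ∈ hyperplanesBetween (w ⊓ y) (x ⊔ w) \
      hyperplanesBetween ((x ⊔ w) ⊓ y) (x ⊔ w) :=
    ⟨⟨inf_le_left, le_sup_right, by rw [h.finrank_right, h.finrank_sup]⟩,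
      fun hw => h.not_inf_le ((inf_le_inf_right y le_sup_left).trans hw.1)⟩
  have h3 := Set.ncard_sdiff_singleton_add_one h2
  have h4 := Set.ncard_sdiff_add_ncard_of_subset h1
  have h5 := h.symm.ncard_hyperplanesBetween_inf
  rw [sup_comm] at h5
  rw [← h5, ← h.ncard_hyperplanesBetween_sup_inf, ← h4, ← h3]
  push_cast
  ring

theorem ncard_typeMinus_typeMinus (h : IsMinusPair y k s x w) (hy : finrank F y = k) :
    (((linesBetween (x ⊓ w) (x ⊓ w ⊔ y) \ {x, w}) ∪
      ((hyperplanesBetween ⊥ (x ⊔ w) \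
        (hyperplanesBetween (x ⊓ y) (x ⊔ w) ∪ hyperplanesBetween (w ⊓ y) (x ⊔ w))) \
        linesBetween (x ⊓ w) (x ⊔ w))).ncard : ℚ) =
      gaussQ (Fintype.card F) (k + 1) - gaussQ (Fintype.card F) (k + 1 - s) +
        gaussQ (Fintype.card F) (k - s) - gaussQ (Fintype.card F) 2 := by
  have := finite_submodule (F := F) (V := V)
  have hk := h.finrank_inf
  have hne : x ≠ w := h.ne
  have hdisj : Disjoint (linesBetween (x ⊓ w) (x ⊓ w ⊔ y) \ {x, w})
      ((hyperplanesBetween ⊥ (x ⊔ w) \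
        (hyperplanesBetween (x ⊓ y) (x ⊔ w) ∪ hyperplanesBetween (w ⊓ y) (x ⊔ w))) \
        linesBetween (x ⊓ w) (x ⊔ w)) :=
    Set.disjoint_left.2 fun z hz hz' => hz'.2 ⟨hz.1.1, hz'.1.1.2.1, hz.1.2.2⟩
  have hxy : {x, w} ⊆ linesBetween (x ⊓ w) (x ⊓ w ⊔ y) := by
    have hsub {a : Submodule F V} (e : x ⊓ w ⊔ a ⊓ y = a) (hd : finrank F a = k)
        (hle : x ⊓ w ≤ a) : a ∈ linesBetween (x ⊓ w) (x ⊓ w ⊔ y) :=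
      ⟨hle, e.ge.trans (sup_le_sup_left inf_le_right _), hd.trans hk.symm⟩
    rintro a (rfl | rfl)
    · exact hsub h.inf_sup_inf h.finrank_left inf_le_left
    · exact hsub (inf_comm x a ▸ h.symm.inf_sup_inf) h.finrank_right inf_le_right
  have hxw : {x, w} ⊆ linesBetween (x ⊓ w) (x ⊔ w) := by
    rintro a (rfl | rfl)
    · exact ⟨inf_le_left, le_sup_left, h.finrank_left.trans hk.symm⟩
    · exact ⟨inf_le_right, le_sup_right, h.finrank_right.trans hk.symm⟩
  have hinter : (hyperplanesBetween ⊥ (x ⊔ w) \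
      (hyperplanesBetween (x ⊓ y) (x ⊔ w) ∪ hyperplanesBetween (w ⊓ y) (x ⊔ w))) ∩
        linesBetween (x ⊓ w) (x ⊔ w) = linesBetween (x ⊓ w) (x ⊔ w) \ {x, w} := by
    ext z
    constructor
    · rintro ⟨⟨⟨-, h1, h2⟩, h3⟩, h4⟩
      refine ⟨h4, ?_⟩
      rintro (rfl | rfl)
      exacts [h3 (Or.inl ⟨inf_le_left, h1, h2⟩), h3 (Or.inr ⟨inf_le_left, h1, h2⟩)]
    · rintro ⟨⟨h1, h2, h3⟩, h4⟩
      have hd := h3.trans hk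
      refine ⟨⟨⟨bot_le, h2, by rw [hd, h.finrank_sup]⟩, ?_⟩, h1, h2, h3⟩
      rintro (⟨h5, -⟩ | ⟨h5, -⟩)
      · exact h4 (Or.inl (h.eq_of_inf_le h1 h5 hd))
      · exact h4 (Or.inr (h.symm.eq_of_inf_le (inf_comm x w ▸ h1) h5 hd))
  have hunion : hyperplanesBetween (x ⊓ y) (x ⊔ w) ∪ hyperplanesBetween (w ⊓ y) (x ⊔ w) ⊆
      hyperplanesBetween ⊥ (x ⊔ w) := by
    rintro z (hz | hz) <;> exact ⟨bot_le, hz.2⟩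
  have hcap : hyperplanesBetween (x ⊓ y) (x ⊔ w) ∩ hyperplanesBetween (w ⊓ y) (x ⊔ w) =
      hyperplanesBetween ((x ⊔ w) ⊓ y) (x ⊔ w) := by
    ext z
    rw [h.sup_inf_eq]
    exact ⟨fun hz => ⟨sup_le hz.1.1 hz.2.1, hz.1.2⟩,
      fun hz => ⟨⟨le_sup_left.trans hz.1, hz.2⟩, le_sup_right.trans hz.1, hz.2⟩⟩
  have c1 := Set.ncard_union_eq hdisj
  have c2 := Set.ncard_sdiff_add_ncard_of_subset hxy
  have c3 := Set.ncard_sdiff_add_ncard_of_subset hxw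
  have c4 := Set.ncard_inter_add_ncard_sdiff_eq_ncard (hyperplanesBetween ⊥ (x ⊔ w) \
      (hyperplanesBetween (x ⊓ y) (x ⊔ w) ∪ hyperplanesBetween (w ⊓ y) (x ⊔ w)))
      (linesBetween (x ⊓ w) (x ⊔ w))
  have c5 := Set.ncard_sdiff_add_ncard_of_subset hunion
  have c6 := Set.ncard_union_add_ncard_inter (hyperplanesBetween (x ⊓ y) (x ⊔ w))
    (hyperplanesBetween (w ⊓ y) (x ⊔ w))
  rw [Set.ncard_pair hne] at c2 c3
  rw [hinter] at c4
  rw [hcap] at c6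
  have d1 : ((linesBetween (x ⊓ w) (x ⊓ w ⊔ y)).ncard : ℚ) =
      gaussQ (Fintype.card F) (k + 1 - s) := by
    rw [ncard_linesBetween le_sup_left]
    congr 1
    have e1 := Submodule.finrank_sup_add_finrank_inf_eq (x ⊓ w) y
    have e2 := h.finrank_inf_inf
    omega
  have d2 : ((linesBetween (x ⊓ w) (x ⊔ w)).ncard : ℚ) = gaussQ (Fintype.card F) 2 := by
    rw [ncard_linesBetween (inf_le_left.trans le_sup_left), h.finrank_sup]
    congr 1
    omega
  have d3 : ((hyperplanesBetween ⊥ (x ⊔ w)).ncard : ℚ) = gaussQ (Fintype.card F) (k + 1) := by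
    rw [ncard_hyperplanesBetween bot_le, h.finrank_sup, finrank_bot, Nat.sub_zero]
  have d4 := h.ncard_hyperplanesBetween_inf
  have d5 := h.symm.ncard_hyperplanesBetween_inf
  have d6 := h.ncard_hyperplanesBetween_sup_inf
  rw [sup_comm] at d5
  rw [c1, ← d3, ← d2, ← d6]
  have d7 := d1.trans d4.symm
  have d8 := d1.trans d5.symm
  rw [← d1]
  norm_cast at d7 d8
  push_cast
  qify at c2 c3 c4 c5 c6 d7 d8
  linarith

end IsMinusPair

theorem gaussQ_succ_sub {q : ℕ} (hq : 1 < q) (m : ℕ) :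
    gaussQ q (m + 1) - gaussQ q m = (q : ℚ) ^ m := by
  have h : (q : ℚ) - 1 ≠ 0 := sub_ne_zero.2 (by exact_mod_cast hq.ne')
  simp only [gaussQ]
  field_simp
  ring

theorem gaussQ_succ {q : ℕ} (hq : 1 < q) (m : ℕ) : gaussQ q (m + 1) = q * gaussQ q m + 1 := by
  have h : (q : ℚ) - 1 ≠ 0 := sub_ne_zero.2 (by exact_mod_cast hq.ne')
  simp only [gaussQ]
  field_simp
  ring

theorem sub_one_mul_gaussQ {q : ℕ} (hq : 1 < q) (m : ℕ) :
    ((q : ℚ) - 1) * gaussQ q m = (q : ℚ) ^ m - 1 :=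
  mul_div_cancel₀ _ (sub_ne_zero.2 (by exact_mod_cast hq.ne'))

end Cardinalities

section Distance

variable {k : ℕ}

theorem grass_adj_iff (hk : 0 < k) (a b : GrassVertex F V k) :
    (Grass F V k).Adj a b ↔ AreAdjacent k a.1 b.1 := by
  rw [Grass, SimpleGraph.fromRel_adj, inf_comm b.1 a.1, or_self]
  constructor
  · rintro ⟨-, h⟩
    exact ⟨a.2, b.2, by omega⟩
  · intro h
    exact ⟨fun he => h.ne (congrArg Subtype.val he), by have := h.finrank_inf; omega⟩

variable [FiniteDimensional F V]

theorem AreAdjacent.finrank_inf_le {a b : Submodule F V} (h : AreAdjacent k a b)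
    (y : Submodule F V) : finrank F ↥(b ⊓ y) ≤ finrank F ↥(a ⊓ y) + 1 := by
  have h1 := Submodule.finrank_sup_add_finrank_inf_eq (a ⊓ b) (b ⊓ y)
  have h2 := Submodule.finrank_mono (sup_le inf_le_right inf_le_left : a ⊓ b ⊔ b ⊓ y ≤ b)
  have h3 := Submodule.finrank_mono
    (inf_le_inf inf_le_left inf_le_right : a ⊓ b ⊓ (b ⊓ y) ≤ a ⊓ y)
  have := h.finrank_inf
  have := h.finrank_right
  omega

theorem le_length_add_finrank_inf (hk : 0 < k) {x y : GrassVertex F V k}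
    (p : (Grass F V k).Walk x y) : k ≤ p.length + finrank F ↥(x.1 ⊓ y.1) := by
  induction p with
  | @nil a => rw [inf_idem, a.2]; exact Nat.le_add_left _ _
  | @cons a b c h p ih =>
    have := ((grass_adj_iff hk a b).1 h).finrank_inf_le c.1
    rw [SimpleGraph.Walk.length_cons]
    omega

theorem exists_walk_length_le (hk : 0 < k) (y : GrassVertex F V k) (m : ℕ) :
    ∀ x : GrassVertex F V k, k ≤ m + finrank F ↥(x.1 ⊓ y.1) →
      ∃ p : (Grass F V k).Walk x y, p.length ≤ m := by
  induction m with
  | zero =>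
    intro x hx
    have h1 : x.1 ⊓ y.1 = x.1 :=
      Submodule.eq_of_le_of_finrank_le inf_le_left (by rw [x.2]; omega)
    have h2 : x = y := Subtype.ext
      (Submodule.eq_of_le_of_finrank_eq (inf_eq_left.1 h1) (x.2.trans y.2.symm))
    subst h2
    exact ⟨.nil, le_rfl⟩
  | succ m ih =>
    intro x hx
    by_cases hle : x.1 ≤ y.1
    · have h2 : x = y := Subtype.ext
        (Submodule.eq_of_le_of_finrank_eq hle (x.2.trans y.2.symm))
      subst h2
      exact ⟨.nil, Nat.zero_le _⟩
    · obtain ⟨U, hU, hUx, hd⟩ := exists_le_finrank_add_one_eq (inf_lt_left.2 hle)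
      rw [x.2] at hd
      have hyx : ¬y.1 ≤ x.1 := fun h =>
        hle (Submodule.eq_of_le_of_finrank_eq h (y.2.trans x.2.symm)).ge
      obtain ⟨v, hvy, hvx⟩ := SetLike.not_le_iff_exists.1 hyx
      have hz := Submodule.finrank_sup_span_singleton (K := F) fun hv => hvx (hUx hv)
      have hle' : x.1 ⊓ y.1 ⊔ Submodule.span F {v} ≤ (U ⊔ Submodule.span F {v}) ⊓ y.1 :=
        sup_le (le_inf (hU.trans le_sup_left) inf_le_right)
          (le_inf le_sup_right ((Submodule.span_singleton_le_iff_mem v _).2 hvy))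
      have h1 := Submodule.finrank_mono hle'
      rw [Submodule.finrank_sup_span_singleton fun hv => hvx (inf_le_left (a := x.1) hv)] at h1
      have hadj : AreAdjacent k x.1 (U ⊔ Submodule.span F {v}) := by
        refine ⟨x.2, hz.trans hd, ?_⟩
        have h2 := Submodule.finrank_mono (le_inf hUx le_sup_left :
          U ≤ x.1 ⊓ (U ⊔ Submodule.span F {v}))
        have h3 : ¬U ⊔ Submodule.span F {v} ≤ x.1 := fun h =>
          hvx (h (Submodule.mem_sup_right (Submodule.mem_span_singleton_self v)))
        have h4 := Submodule.finrank_lt_finrank_of_lt (inf_lt_right.2 h3)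
        omega
      obtain ⟨p, hp⟩ := ih ⟨_, hadj.finrank_right⟩ (by dsimp only; omega)
      exact ⟨.cons ((grass_adj_iff hk x ⟨_, hadj.finrank_right⟩).2 hadj) p,
        Nat.succ_le_succ hp⟩

theorem grass_dist_add_finrank_inf (hk : 0 < k) (x y : GrassVertex F V k) :
    (Grass F V k).dist x y + finrank F ↥(x.1 ⊓ y.1) = k := by
  have h1 : finrank F ↥(x.1 ⊓ y.1) ≤ k := by
    have := Submodule.finrank_mono (inf_le_left : x.1 ⊓ y.1 ≤ x.1)
    rwa [x.2] at this
  obtain ⟨p, hp⟩ := exists_walk_length_le hk y (k - finrank F ↥(x.1 ⊓ y.1)) x (by omega)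
  obtain ⟨p', hp'⟩ := p.reachable.exists_walk_length_eq_dist
  have h2 := le_length_add_finrank_inf hk p'
  have h3 := SimpleGraph.dist_le p
  omega

end Distance

theorem ncard_grassVertex_eq {k : ℕ} {P : GrassVertex F V k → Prop}
    {S : Set (Submodule F V)} (h : ∀ z, P z ↔ z.1 ∈ S) (hS : ∀ z ∈ S, finrank F z = k) :
    {z | P z}.ncard = S.ncard := by
  have : {z | P z} = Subtype.val ⁻¹' S := Set.ext h
  rw [this, Set.ncard_preimage_of_injective_subset_range Subtype.val_injective]
  intro z hz
  exact ⟨⟨z, hS z hz⟩, rfl⟩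

theorem statement19
    (q n k : ℕ) (hq : IsPrimePow q) (hkn : 2 * k < n) (hk : 3 ≤ k)
    (F V : Type) [Field F] [Fintype F] (hcard : Fintype.card F = q)
    [AddCommGroup V] [Module F V] [FiniteDimensional F V]
    (hdim : Module.finrank F V = n)
    [Fintype (Submodule F V)]
    (x y : GrassVertex F V k)
    (i : ℕ) (hi : (Grass F V k).dist x y = i) (hi1 : 1 < i) (hi2 : i < k)
    (w : GrassVertex F V k) (hw : w ∈ Amset x y) :
    ({z | z ∈ A0set x y ∧ (Grass F V k).Adj w z ∧ EdgeType0 y w z}.ncard : ℚ) = 0 ∧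
    ({z | z ∈ A0set x y ∧ (Grass F V k).Adj w z ∧ EdgeTypeP y w z}.ncard : ℚ) = 0 ∧
    ({z | z ∈ A0set x y ∧ (Grass F V k).Adj w z ∧ EdgeTypeM y w z}.ncard : ℚ) = ((q : ℚ) - 1) * gaussQ q i ∧
    ({z | z ∈ Apset x y ∧ (Grass F V k).Adj w z ∧ EdgeType0 y w z}.ncard : ℚ) = 0 ∧
    ({z | z ∈ Apset x y ∧ (Grass F V k).Adj w z ∧ EdgeTypeP y w z}.ncard : ℚ) = 0 ∧
    ({z | z ∈ Apset x y ∧ (Grass F V k).Adj w z ∧ EdgeTypeM y w z}.ncard : ℚ) = 0 ∧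
    ({z | z ∈ Amset x y ∧ (Grass F V k).Adj w z ∧ EdgeType0 y w z}.ncard : ℚ) = ((q : ℚ) - 1) * gaussQ q i ∧
    ({z | z ∈ Amset x y ∧ (Grass F V k).Adj w z ∧ EdgeTypeP y w z}.ncard : ℚ) = 0 ∧
    ({z | z ∈ Amset x y ∧ (Grass F V k).Adj w z ∧ EdgeTypeM y w z}.ncard : ℚ) = (q : ℚ) * gaussQ q k - (q : ℚ) ^ i - q := by
  have hk0 : 0 < k := by omega
  have hq1 : 1 < q := hcard ▸ Fintype.one_lt_card
  have hs := grass_dist_add_finrank_inf hk0 x y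
  rw [hi] at hs
  obtain ⟨hxw, hm⟩ := hw
  have h : IsMinusPair y.1 k (finrank F ↥(x.1 ⊓ y.1)) x.1 w.1 :=
    (IsMinusPair.of_typeMinus ((grass_adj_iff hk0 x w).1 hxw).symm rfl hm).symm
  generalize finrank F ↥(x.1 ⊓ y.1) = s at hs h
  have hks : k - s = i := by omega
  have hks' : k + 1 - s = i + 1 := by omega
  have hempty {P : GrassVertex F V k → Prop} (hP : ∀ z, ¬P z) : ({z | P z}.ncard : ℚ) = 0 := by
    simp [hP]
  have hcount {x w : GrassVertex F V k} (h : IsMinusPair y.1 k s x.1 w.1) :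
      (((hyperplanesBetween (w.1 ⊓ y.1) (x.1 ⊔ w.1) \
        hyperplanesBetween ((x.1 ⊔ w.1) ⊓ y.1) (x.1 ⊔ w.1)) \ {w.1}).ncard : ℚ) =
        ((q : ℚ) - 1) * gaussQ q i := by
    rw [h.ncard_typeMinus_typeZero, hcard, hks, hks', gaussQ_succ_sub hq1,
      sub_one_mul_gaussQ hq1]
  refine ⟨hempty ?_, hempty ?_, ?_, hempty ?_, hempty ?_, hempty ?_, ?_, hempty ?_, ?_⟩
  · rintro z ⟨⟨hzx, hz⟩, hwz, hz'⟩
    rw [grass_adj_iff hk0] at hzx hwz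
    exact h.inf_ne_inf ((hzx.symm.typeZero_iff.1 hz).1.symm.trans
      (hwz.typeZero_iff.1 hz').1.symm)
  · rintro z ⟨⟨hzx, hz⟩, hwz, hz'⟩
    rw [grass_adj_iff hk0] at hzx hwz
    have := hwz.typePlus_iff.1 hz'
    exact h.inf_ne_inf ((hzx.symm.typeZero_iff.1 hz).1.symm.trans
      (this.2.trans this.1.symm))
  · rw [← hcount h.symm]
    congr 1
    refine ncard_grassVertex_eq (fun z => ?_) ?_
    · rw [← h.symm.typeMinus_and_typeZero_iff]
      simp only [A0set, EdgeTypeM, Set.mem_ofPred_eq, grass_adj_iff hk0]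
      rw [sup_comm z.1 x.1, inf_comm z.1 x.1, inf_comm w.1 z.1]
      constructor
      · rintro ⟨⟨a, b, c, d, e⟩, f, g, j⟩
        exact ⟨⟨f.symm, j, g⟩, a, c, b, e, d⟩
      · rintro ⟨⟨f, j, g⟩, a, c, b, e, d⟩
        exact ⟨⟨a, b, c, d, e⟩, f.symm, g, j⟩
    · rintro z ⟨⟨⟨-, -, hz⟩, -⟩, -⟩
      rw [h.symm.finrank_sup] at hz
      omega
  · rintro z ⟨⟨hzx, hz⟩, hwz, -⟩
    rw [grass_adj_iff hk0] at hzx hwz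
    exact h.not_typePlus hzx.symm hwz hz
  · rintro z ⟨⟨hzx, hz⟩, hwz, -⟩
    rw [grass_adj_iff hk0] at hzx hwz
    exact h.not_typePlus hzx.symm hwz hz
  · rintro z ⟨⟨hzx, hz⟩, hwz, -⟩
    rw [grass_adj_iff hk0] at hzx hwz
    exact h.not_typePlus hzx.symm hwz hz
  · rw [← hcount h]
    congr 1
    refine ncard_grassVertex_eq (fun z => ?_) ?_
    · rw [← h.typeMinus_and_typeZero_iff]
      simp only [Amset, EdgeType0, Set.mem_ofPred_eq, grass_adj_iff hk0]
      rw [AreAdjacent.comm (a := x.1)]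
    · rintro z ⟨⟨⟨-, -, hz⟩, -⟩, -⟩
      rw [h.finrank_sup] at hz
      omega
  · rintro z ⟨⟨hzx, -⟩, hwz, hz⟩
    rw [grass_adj_iff hk0] at hzx hwz
    refine h.symm.not_typePlus hwz.symm hzx ?_
    rw [sup_comm]
    exact hz.symm
  · have hgoal : (q : ℚ) * gaussQ q k - (q : ℚ) ^ i - q =
        gaussQ q (k + 1) - gaussQ q (i + 1) + gaussQ q i - gaussQ q 2 := by
      have h2 : gaussQ q 2 = q + 1 := by
        rw [gaussQ_succ hq1, gaussQ_succ hq1]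
        simp [gaussQ]
      rw [gaussQ_succ hq1 k, h2, ← gaussQ_succ_sub hq1 i]
      ring
    have hcard' := h.ncard_typeMinus_typeMinus y.2
    rw [hcard, hks, hks', ← hgoal] at hcard'
    rw [← hcard']
    congr 1
    refine ncard_grassVertex_eq (fun z => ?_) ?_
    · rw [← h.typeMinus_and_typeMinus_iff]
      simp only [Amset, EdgeTypeM, Set.mem_ofPred_eq, grass_adj_iff hk0]
      rw [AreAdjacent.comm (a := x.1)]
    · rintro z (⟨⟨-, -, hz⟩, -⟩ | ⟨⟨⟨-, -, hz⟩, -⟩, -⟩)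
      · exact hz.trans h.finrank_inf
      · rw [h.finrank_sup] at hz
        omega
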